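/- Let K be a field of characteristic 2, let A = K[U,V,W,X,Y,Z]_m/(UX+VY+WZ) be the localization of K[U,V,W,X,Y,Z]/(UX+VY+WZ) at the maximal ideal m = (U,V,W,X,Y,Z), with u,v,w,x,y,z the images of the variables, let P = (u,v,w)A, let Ω be an algebraic closure of Frac(A), let a, b, c, d, e ∈ Ω be the square roots of uyz, vxz, wxy, uvw, vwyz respectively, and let R = A[a,b,c,d,e] ⊆ Ω. Then there is a surjective A-module homomorphism π : R → P satisfying π(1) = 0, π(a) = u, π(b) = v, π(c) = w, π(d) = 0, π(e) = 0, and the kernel of π is a free A-module of rank 3; that is, there is a short exact sequence of A-modules 0 → A³ → R → P → 0. -/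

import Mathlib

open MvPolynomial

set_option maxHeartbeats 1000000
set_option synthInstance.maxHeartbeats 1000000

noncomputable section

/-- The polynomial `UX + VY + WZ` (variables: `0 = U, 1 = V, 2 = W, 3 = X, 4 = Y, 5 = Z`). -/
def bPoly (K : Type) [Field K] : MvPolynomial (Fin 6) K :=
  X 0 * X 3 + X 1 * X 4 + X 2 * X 5

/-- The hypersurface `K[U,V,W,X,Y,Z]/(UX+VY+WZ)`. -/
def Bring (K : Type) [Field K] : Type :=
  MvPolynomial (Fin 6) K ⧸ Ideal.span {bPoly K}

instance (K : Type) [Field K] : CommRing (Bring K) :=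
  inferInstanceAs (CommRing (MvPolynomial (Fin 6) K ⧸ Ideal.span {bPoly K}))

/-- The quotient map onto the hypersurface. -/
def bMk (K : Type) [Field K] : MvPolynomial (Fin 6) K →+* Bring K :=
  Ideal.Quotient.mk (Ideal.span {bPoly K})

/-- The maximal ideal of `Bring K` generated by the images of the variables. -/
def mIdeal (K : Type) [Field K] : Ideal (Bring K) :=
  Ideal.span (Set.range fun i : Fin 6 => bMk K (X i))

/-- `A`, the localization of the hypersurface at the maximal ideal `m`. -/
def Aring (K : Type) [Field K] [(mIdeal K).IsPrime] : Type :=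
  Localization (mIdeal K).primeCompl

instance (K : Type) [Field K] [(mIdeal K).IsPrime] : CommRing (Aring K) :=
  inferInstanceAs (CommRing (Localization (mIdeal K).primeCompl))

instance (K : Type) [Field K] [(mIdeal K).IsPrime] : Algebra (Bring K) (Aring K) :=
  inferInstanceAs (Algebra (Bring K) (Localization (mIdeal K).primeCompl))

variable (K : Type) [Field K] [(mIdeal K).IsPrime]

/-- `u`, the image of `U` in `A`. -/
def uElt : Aring K := algebraMap (Bring K) (Aring K) (bMk K (X 0))
/-- `v`, the image of `V` in `A`. -/
def vElt : Aring K := algebraMap (Bring K) (Aring K) (bMk K (X 1))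
/-- `w`, the image of `W` in `A`. -/
def wElt : Aring K := algebraMap (Bring K) (Aring K) (bMk K (X 2))
/-- `x`, the image of `X` in `A`. -/
def xElt : Aring K := algebraMap (Bring K) (Aring K) (bMk K (X 3))
/-- `y`, the image of `Y` in `A`. -/
def yElt : Aring K := algebraMap (Bring K) (Aring K) (bMk K (X 4))
/-- `z`, the image of `Z` in `A`. -/
def zElt : Aring K := algebraMap (Bring K) (Aring K) (bMk K (X 5))

/-- The ideal `P = (u, v, w)` of `A`. -/
def Pideal : Ideal (Aring K) := Ideal.span {uElt K, vElt K, wElt K}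

/-- `L = Frac(A)`, the fraction field of `A`. -/
def Lfield (K : Type) [Field K] [(mIdeal K).IsPrime] : Type :=
  FractionRing (Aring K)

instance (K : Type) [Field K] [(mIdeal K).IsPrime] [IsDomain (Aring K)] :
    Field (Lfield K) := inferInstanceAs (Field (FractionRing (Aring K)))

instance (K : Type) [Field K] [(mIdeal K).IsPrime] [IsDomain (Aring K)] :
    Algebra (Aring K) (Lfield K) := inferInstanceAs (Algebra (Aring K) (FractionRing (Aring K)))

variable (K : Type) [Field K] [(mIdeal K).IsPrime] [IsDomain (Aring K)]

/-- `Ω`, an algebraic closure of `L`. -/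
def Omega : Type := AlgebraicClosure (Lfield K)

instance : Field (Omega K) := inferInstanceAs (Field (AlgebraicClosure (Lfield K)))

instance : Algebra (Lfield K) (Omega K) :=
  inferInstanceAs (Algebra (Lfield K) (AlgebraicClosure (Lfield K)))

instance : IsAlgClosed (Omega K) := inferInstanceAs (IsAlgClosed (AlgebraicClosure (Lfield K)))

instance : Algebra.IsAlgebraic (Lfield K) (Omega K) :=
  inferInstanceAs (Algebra.IsAlgebraic (Lfield K) (AlgebraicClosure (Lfield K)))

instance : Algebra (Aring K) (Omega K) :=
  ((algebraMap (Lfield K) (Omega K)).comp (algebraMap (Aring K) (Lfield K))).toAlgebra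

/-- The image of an element of `A` in `Ω`. -/
def toOmega (α : Aring K) : Omega K := algebraMap (Aring K) (Omega K) α

variable (a b c d e : Omega K)

/-- The subring `R = A[a,b,c,d,e]` of `Ω`. -/
def adjoinT : Subalgebra (Aring K) (Omega K) :=
  Algebra.adjoin (Aring K) {a, b, c, d, e}

/-- The image of `u` in `R`. -/
def uT : adjoinT K a b c d e := algebraMap (Aring K) (adjoinT K a b c d e) (uElt K)
/-- The image of `v` in `R`. -/
def vT : adjoinT K a b c d e := algebraMap (Aring K) (adjoinT K a b c d e) (vElt K)
/-- The image of `w` in `R`. -/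
def wT : adjoinT K a b c d e := algebraMap (Aring K) (adjoinT K a b c d e) (wElt K)
/-- The image of `x` in `R`. -/
def xT : adjoinT K a b c d e := algebraMap (Aring K) (adjoinT K a b c d e) (xElt K)
/-- The image of `y` in `R`. -/
def yT : adjoinT K a b c d e := algebraMap (Aring K) (adjoinT K a b c d e) (yElt K)
/-- The image of `z` in `R`. -/
def zT : adjoinT K a b c d e := algebraMap (Aring K) (adjoinT K a b c d e) (zElt K)

/-- `a` as an element of `R`. -/
def aT : adjoinT K a b c d e := ⟨a, Algebra.subset_adjoin (by simp)⟩
/-- `b` as an element of `R`. -/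
def bT : adjoinT K a b c d e := ⟨b, Algebra.subset_adjoin (by simp)⟩
/-- `c` as an element of `R`. -/
def cT : adjoinT K a b c d e := ⟨c, Algebra.subset_adjoin (by simp)⟩
/-- `d` as an element of `R`. -/
def dT : adjoinT K a b c d e := ⟨d, Algebra.subset_adjoin (by simp)⟩
/-- `e` as an element of `R`. -/
def eT : adjoinT K a b c d e := ⟨e, Algebra.subset_adjoin (by simp)⟩

section Abstract

variable {A Ω : Type*} [CommRing A] [Field Ω] [Algebra A Ω]

theorem eq_of_sq_eq_sq_of_two_eq_zero {F : Type*} [Field F] (h2 : (2 : F) = 0) {p q : F}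
    (h : p ^ 2 = q ^ 2) : p = q := by
  have : (p - q) ^ 2 = 0 := by linear_combination h + (q ^ 2 - p * q) * h2
  exact sub_eq_zero.mp (pow_eq_zero_iff two_ne_zero |>.mp this)

/-- Linear maps out of a module descend along a surjection whose kernel they kill. -/
theorem exists_linearMap_comp_eq {M N Q : Type*} [AddCommGroup M] [AddCommGroup N]
    [AddCommGroup Q] [Module A M] [Module A N] [Module A Q] (θ : M →ₗ[A] N) (ρ : M →ₗ[A] Q)
    (hθ : Function.Surjective θ) (h : ∀ t, θ t = 0 → ρ t = 0) :
    ∃ π : N →ₗ[A] Q, ∀ t, π (θ t) = ρ t := by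
  refine ⟨(LinearMap.ker θ).liftQ ρ (fun t ht => h t ht) ∘ₗ
    (θ.quotKerEquivOfSurjective hθ).symm.toLinearMap, fun t => ?_⟩
  have : (θ.quotKerEquivOfSurjective hθ).symm (θ t) = (LinearMap.ker θ).mkQ t := by
    rw [LinearEquiv.symm_apply_eq]; rfl
  simp only [LinearMap.comp_apply, LinearEquiv.coe_coe, this]
  rfl

/-- The square-root extension `A[a, b, c, d, e]` is spanned by `1, a, b, c, d, e`. -/
theorem exists_coeffs_of_mem_adjoin_sqrt (h2 : (2 : A) = 0) {u v w x y z : A}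
    (hf : u * x + v * y + w * z = 0) {a b c d e : Ω}
    (ha : a ^ 2 = algebraMap A Ω (u * y * z)) (hb : b ^ 2 = algebraMap A Ω (v * x * z))
    (hc : c ^ 2 = algebraMap A Ω (w * x * y)) (hd : d ^ 2 = algebraMap A Ω (u * v * w))
    (he : e ^ 2 = algebraMap A Ω (v * w * y * z)) {r : Ω}
    (hr : r ∈ Algebra.adjoin A {a, b, c, d, e}) :
    ∃ t : Fin 6 → A, r = algebraMap A Ω (t 0) + algebraMap A Ω (t 1) * a +
      algebraMap A Ω (t 2) * b + algebraMap A Ω (t 3) * c + algebraMap A Ω (t 4) * d +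
      algebraMap A Ω (t 5) * e := by
  have k2 : (2 : Ω) = 0 := by simpa only [map_ofNat, map_zero] using congrArg (algebraMap A Ω) h2
  have kf := congrArg (algebraMap A Ω) hf
  simp only [map_add, map_mul, map_zero] at ha hb hc hd he kf
  induction hr using Algebra.adjoin_induction with
  | mem r hr =>
    simp only [Set.mem_insert_iff, Set.mem_singleton_iff] at hr
    rcases hr with rfl | rfl | rfl | rfl | rfl
    · exact ⟨![0, 1, 0, 0, 0, 0], by simp⟩
    · exact ⟨![0, 0, 1, 0, 0, 0], by simp⟩
    · exact ⟨![0, 0, 0, 1, 0, 0], by simp⟩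
    · exact ⟨![0, 0, 0, 0, 1, 0], by simp⟩
    · exact ⟨![0, 0, 0, 0, 0, 1], by simp⟩
  | algebraMap r => exact ⟨![r, 0, 0, 0, 0, 0], by simp⟩
  | add r s _ _ hr hs =>
    obtain ⟨t, rfl⟩ := hr
    obtain ⟨t', rfl⟩ := hs
    refine ⟨t + t', ?_⟩
    simp only [Pi.add_apply, map_add]
    ring
  | mul r s _ _ hr hs =>
    obtain ⟨t, rfl⟩ := hr
    obtain ⟨t', rfl⟩ := hs
    refine ⟨![t 0 * t' 0 + t 1 * t' 1 * (u * y * z) + t 2 * t' 2 * (v * x * z)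
        + t 3 * t' 3 * (w * x * y) + t 4 * t' 4 * (u * v * w) + t 5 * t' 5 * (v * w * y * z)
        + (t 1 * t' 2 + t 2 * t' 1) * (v * y * z) + (t 1 * t' 3 + t 3 * t' 1) * (y * w * z)
        + (t 2 * t' 4 + t 4 * t' 2) * (v * w * z) + (t 3 * t' 4 + t 4 * t' 3) * (v * w * y),
      t 0 * t' 1 + t 1 * t' 0 + (t 4 * t' 5 + t 5 * t' 4) * (v * w),
      t 0 * t' 2 + t 2 * t' 0 + (t 3 * t' 5 + t 5 * t' 3) * (w * y),
      t 0 * t' 3 + t 3 * t' 0 + (t 2 * t' 5 + t 5 * t' 2) * (v * z),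
      t 0 * t' 4 + t 4 * t' 0 + (t 1 * t' 5 + t 5 * t' 1) * (y * z),
      t 0 * t' 5 + t 5 * t' 0 + (t 1 * t' 2 + t 2 * t' 1) * z + (t 1 * t' 3 + t 3 * t' 1) * y
        + (t 2 * t' 3 + t 3 * t' 2) * x + (t 1 * t' 4 + t 4 * t' 1) * u
        + (t 2 * t' 4 + t 4 * t' 2) * v + (t 3 * t' 4 + t 4 * t' 3) * w], ?_⟩
    simp only [Matrix.cons_val, map_add, map_mul]
    generalize algebraMap A Ω u = u at *
    generalize algebraMap A Ω v = v at *
    generalize algebraMap A Ω w = w at *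
    generalize algebraMap A Ω x = x at *
    generalize algebraMap A Ω y = y at *
    generalize algebraMap A Ω z = z at *
    have hab : a * b = z * e + v * y * z := eq_of_sq_eq_sq_of_two_eq_zero k2 (by
      linear_combination b ^ 2 * ha + u * y * z * hb - z ^ 2 * he + v * y * z ^ 2 * kf
        - (v * w * y * z ^ 3 + e * v * y * z ^ 2 + v ^ 2 * y ^ 2 * z ^ 2) * k2)
    have hac : a * c = y * e + y * w * z := eq_of_sq_eq_sq_of_two_eq_zero k2 (by
      linear_combination c ^ 2 * ha + u * y * z * hc - y ^ 2 * he + w * z * y ^ 2 * kf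
        - (v * w * y ^ 3 * z + e * w * y ^ 2 * z + w ^ 2 * y ^ 2 * z ^ 2) * k2)
    have hbc : b * c = x * e := eq_of_sq_eq_sq_of_two_eq_zero k2 (by
      linear_combination c ^ 2 * hb + v * x * z * hc - x ^ 2 * he)
    have had : a * d = u * e := eq_of_sq_eq_sq_of_two_eq_zero k2 (by
      linear_combination d ^ 2 * ha + u * y * z * hd - u ^ 2 * he)
    have hbd : b * d = v * e + v * w * z := eq_of_sq_eq_sq_of_two_eq_zero k2 (by
      linear_combination d ^ 2 * hb + v * x * z * hd - v ^ 2 * he + v ^ 2 * w * z * kf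
        - (v ^ 3 * w * y * z + e * v ^ 2 * w * z + v ^ 2 * w ^ 2 * z ^ 2) * k2)
    have hcd : c * d = w * e + v * w * y := eq_of_sq_eq_sq_of_two_eq_zero k2 (by
      linear_combination d ^ 2 * hc + w * x * y * hd - w ^ 2 * he + w ^ 2 * v * y * kf
        - (v * w ^ 3 * y * z + e * w ^ 2 * v * y + v ^ 2 * w ^ 2 * y ^ 2) * k2)
    have hae : a * e = y * z * d := eq_of_sq_eq_sq_of_two_eq_zero k2 (by
      linear_combination e ^ 2 * ha + u * y * z * he - y ^ 2 * z ^ 2 * hd)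
    have hbe : b * e = v * z * c := eq_of_sq_eq_sq_of_two_eq_zero k2 (by
      linear_combination e ^ 2 * hb + v * x * z * he - v ^ 2 * z ^ 2 * hc)
    have hce : c * e = w * y * b := eq_of_sq_eq_sq_of_two_eq_zero k2 (by
      linear_combination e ^ 2 * hc + w * x * y * he - w ^ 2 * y ^ 2 * hb)
    have hde : d * e = v * w * a := eq_of_sq_eq_sq_of_two_eq_zero k2 (by
      linear_combination e ^ 2 * hd + u * v * w * he - v ^ 2 * w ^ 2 * ha)
    generalize hτ : (fun i => algebraMap A Ω (t i)) = τ
    generalize hτ' : (fun i => algebraMap A Ω (t' i)) = τ'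
    have e1 : ∀ i, algebraMap A Ω (t i) = τ i := fun i => congrFun hτ i
    have e2 : ∀ i, algebraMap A Ω (t' i) = τ' i := fun i => congrFun hτ' i
    simp only [e1, e2]
    linear_combination τ 1 * τ' 1 * ha + τ 2 * τ' 2 * hb + τ 3 * τ' 3 * hc + τ 4 * τ' 4 * hd
      + τ 5 * τ' 5 * he + (τ 1 * τ' 2 + τ 2 * τ' 1) * hab + (τ 1 * τ' 3 + τ 3 * τ' 1) * hac
      + (τ 2 * τ' 3 + τ 3 * τ' 2) * hbc + (τ 1 * τ' 4 + τ 4 * τ' 1) * had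
      + (τ 2 * τ' 4 + τ 4 * τ' 2) * hbd + (τ 3 * τ' 4 + τ 4 * τ' 3) * hcd
      + (τ 1 * τ' 5 + τ 5 * τ' 1) * hae + (τ 2 * τ' 5 + τ 5 * τ' 2) * hbe
      + (τ 3 * τ' 5 + τ 5 * τ' 3) * hce + (τ 4 * τ' 5 + τ 5 * τ' 4) * hde

/-- If `1, a, b, e` are independent and `u, v, w` have only the expected syzygies, then
`A[a, b, c, d, e]` is an extension of `(u, v, w)` by `A³`. -/
theorem exists_ses_of_independent_of_syzygies [IsDomain A] (h2 : (2 : A) = 0)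
    (hinj : Function.Injective (algebraMap A Ω)) {u v w x y z : A}
    (hf : u * x + v * y + w * z = 0) (hz : z ≠ 0)
    (hind : ∀ α β γ ζ : A, α ^ 2 + β ^ 2 * (u * y * z) + γ ^ 2 * (v * x * z) +
      ζ ^ 2 * (v * w * y * z) = 0 → α = 0 ∧ β = 0 ∧ γ = 0 ∧ ζ = 0)
    (hsyz : ∀ β γ δ : A, β * u + γ * v + δ * w = 0 → ∃ s l m n : A,
      β = s * x + l * v + m * w ∧ γ = s * y - l * u + n * w ∧ δ = s * z - m * u - n * v)
    {a b c d e : Ω}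
    (ha : a ^ 2 = algebraMap A Ω (u * y * z)) (hb : b ^ 2 = algebraMap A Ω (v * x * z))
    (hc : c ^ 2 = algebraMap A Ω (w * x * y)) (hd : d ^ 2 = algebraMap A Ω (u * v * w))
    (he : e ^ 2 = algebraMap A Ω (v * w * y * z)) :
    ∃ π : Algebra.adjoin A {a, b, c, d, e} →ₗ[A] (Ideal.span {u, v, w} : Ideal A),
      Function.Surjective π ∧
      π 1 = 0 ∧
      π ⟨a, Algebra.subset_adjoin (by simp)⟩ = ⟨u, Ideal.subset_span (by simp)⟩ ∧
      π ⟨b, Algebra.subset_adjoin (by simp)⟩ = ⟨v, Ideal.subset_span (by simp)⟩ ∧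
      π ⟨c, Algebra.subset_adjoin (by simp)⟩ = ⟨w, Ideal.subset_span (by simp)⟩ ∧
      π ⟨d, Algebra.subset_adjoin (by simp)⟩ = 0 ∧
      π ⟨e, Algebra.subset_adjoin (by simp)⟩ = 0 ∧
      Nonempty ((Fin 3 → A) ≃ₗ[A] LinearMap.ker π) := by
  have k2 : (2 : Ω) = 0 := by simpa only [map_ofNat, map_zero] using congrArg (algebraMap A Ω) h2
  have kf := congrArg (algebraMap A Ω) hf
  have ka := ha
  have kb := hb
  have kc := hc
  have kd := hd
  have ke := he
  simp only [map_add, map_mul, map_zero] at ka kb kc kd ke kf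
  have hxyz : algebraMap A Ω x * a + algebraMap A Ω y * b + algebraMap A Ω z * c = 0 :=
    eq_of_sq_eq_sq_of_two_eq_zero k2 (by
      generalize algebraMap A Ω u = u at *
      generalize algebraMap A Ω v = v at *
      generalize algebraMap A Ω w = w at *
      generalize algebraMap A Ω x = x at *
      generalize algebraMap A Ω y = y at *
      generalize algebraMap A Ω z = z at *
      linear_combination x ^ 2 * ka + y ^ 2 * kb + z ^ 2 * kc + x * y * z * kf
        + (x * y * a * b + x * z * a * c + y * z * b * c) * k2)
  have hzd : algebraMap A Ω v * a - algebraMap A Ω u * b = algebraMap A Ω z * d :=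
    eq_of_sq_eq_sq_of_two_eq_zero k2 (by
      generalize algebraMap A Ω u = u at *
      generalize algebraMap A Ω v = v at *
      generalize algebraMap A Ω w = w at *
      generalize algebraMap A Ω x = x at *
      generalize algebraMap A Ω y = y at *
      generalize algebraMap A Ω z = z at *
      linear_combination v ^ 2 * ka + u ^ 2 * kb - z ^ 2 * kd + u * v * z * kf
        - (u * v * a * b + u * v * w * z ^ 2) * k2)
  have hyd : algebraMap A Ω w * a - algebraMap A Ω u * c = algebraMap A Ω y * d :=
    eq_of_sq_eq_sq_of_two_eq_zero k2 (by
      generalize algebraMap A Ω u = u at *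
      generalize algebraMap A Ω v = v at *
      generalize algebraMap A Ω w = w at *
      generalize algebraMap A Ω x = x at *
      generalize algebraMap A Ω y = y at *
      generalize algebraMap A Ω z = z at *
      linear_combination w ^ 2 * ka + u ^ 2 * kc - y ^ 2 * kd + u * w * y * kf
        - (u * w * a * c + u * v * w * y ^ 2) * k2)
  have hxd : algebraMap A Ω w * b - algebraMap A Ω v * c = algebraMap A Ω x * d :=
    eq_of_sq_eq_sq_of_two_eq_zero k2 (by
      generalize algebraMap A Ω u = u at *
      generalize algebraMap A Ω v = v at *
      generalize algebraMap A Ω w = w at *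
      generalize algebraMap A Ω x = x at *
      generalize algebraMap A Ω y = y at *
      generalize algebraMap A Ω z = z at *
      linear_combination w ^ 2 * kb + v ^ 2 * kc - x ^ 2 * kd + v * w * x * kf
        - (v * w * b * c + u * v * w * x ^ 2) * k2)
  have hrel : ∀ α β γ δ ε ζ : A, algebraMap A Ω α + algebraMap A Ω β * a +
      algebraMap A Ω γ * b + algebraMap A Ω δ * c + algebraMap A Ω ε * d +
      algebraMap A Ω ζ * e = 0 →
      z * α = 0 ∧ z * β - x * δ + v * ε = 0 ∧ z * γ - y * δ - u * ε = 0 ∧ z * ζ = 0 := by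
    intro α β γ δ ε ζ h
    refine hind _ _ _ _ (hinj ?_)
    have h' : algebraMap A Ω (z * α) + algebraMap A Ω (z * β - x * δ + v * ε) * a +
        algebraMap A Ω (z * γ - y * δ - u * ε) * b + algebraMap A Ω (z * ζ) * e = 0 := by
      simp only [map_add, map_sub, map_mul]
      linear_combination algebraMap A Ω z * h - algebraMap A Ω δ * hxyz
        + algebraMap A Ω ε * hzd
    simp only [map_add _ (_ + _) _, map_add _ (_ ^ 2) _, map_pow, map_mul _ (_ ^ 2) _, ← ha,
      ← hb, ← he, map_zero]
    generalize algebraMap A Ω (z * α) = α at *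
    generalize algebraMap A Ω (z * β - x * δ + v * ε) = β at *
    generalize algebraMap A Ω (z * γ - y * δ - u * ε) = γ at *
    generalize algebraMap A Ω (z * ζ) = ζ at *
    linear_combination (α + β * a + γ * b + ζ * e) * h' - (α * β * a + α * γ * b + α * ζ * e
      + β * γ * a * b + β * ζ * a * e + γ * ζ * b * e) * k2
  let R := Algebra.adjoin A {a, b, c, d, e}
  let P : Ideal A := Ideal.span {u, v, w}
  let aR : R := ⟨a, Algebra.subset_adjoin (by simp)⟩
  let bR : R := ⟨b, Algebra.subset_adjoin (by simp)⟩
  let cR : R := ⟨c, Algebra.subset_adjoin (by simp)⟩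
  let dR : R := ⟨d, Algebra.subset_adjoin (by simp)⟩
  let eR : R := ⟨e, Algebra.subset_adjoin (by simp)⟩
  let uP : P := ⟨u, Ideal.subset_span (by simp)⟩
  let vP : P := ⟨v, Ideal.subset_span (by simp)⟩
  let wP : P := ⟨w, Ideal.subset_span (by simp)⟩
  let θ : (Fin 6 → A) →ₗ[A] R := Fintype.linearCombination A ![1, aR, bR, cR, dR, eR]
  let ρ : (Fin 6 → A) →ₗ[A] P := Fintype.linearCombination A ![0, uP, vP, wP, 0, 0]
  let κ : (Fin 3 → A) →ₗ[A] R := Fintype.linearCombination A ![1, dR, eR]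
  have hθ (t) : (θ t : Ω) = algebraMap A Ω (t 0) + algebraMap A Ω (t 1) * a +
      algebraMap A Ω (t 2) * b + algebraMap A Ω (t 3) * c + algebraMap A Ω (t 4) * d +
      algebraMap A Ω (t 5) * e := by
    simp [θ, Fintype.linearCombination_apply, Fin.sum_univ_six, Algebra.smul_def,
      aR, bR, cR, dR, eR]
  have hρ (t) : (ρ t : A) = t 1 * u + t 2 * v + t 3 * w := by
    simp [ρ, Fintype.linearCombination_apply, Fin.sum_univ_six, uP, vP, wP]
  have hκ (t) : (κ t : Ω) = algebraMap A Ω (t 0) + algebraMap A Ω (t 1) * d +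
      algebraMap A Ω (t 2) * e := by
    simp [κ, Fintype.linearCombination_apply, Fin.sum_univ_three, Algebra.smul_def, dR, eR]
  have hθs : Function.Surjective θ := by
    intro r
    obtain ⟨t, ht⟩ := exists_coeffs_of_mem_adjoin_sqrt h2 hf ha hb hc hd he r.2
    exact ⟨t, Subtype.ext ((hθ t).trans ht.symm)⟩
  have hle (t) (ht : θ t = 0) : ρ t = 0 := by
    have h0 := hθ t
    rw [ht] at h0
    obtain ⟨-, hβ, hγ, -⟩ := hrel _ _ _ _ _ _ h0.symm
    refine Subtype.ext ?_
    rw [hρ]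
    refine (mul_eq_zero.mp ?_).resolve_left hz
    linear_combination u * hβ + v * hγ + t 3 * hf
  obtain ⟨π, hπ⟩ := exists_linearMap_comp_eq θ ρ hθs hle
  have hval (t : Fin 6 → A) (r : R) (p : P) (h1 : (θ t : Ω) = r) (h2 : (ρ t : A) = p) :
      π r = p := by
    rw [← Subtype.ext h1, hπ]
    exact Subtype.ext h2
  have hκker (t) : κ t ∈ LinearMap.ker π := by
    refine hval ![t 0, 0, 0, 0, t 1, t 2] (κ t) 0 ?_ ?_
    · simp [hθ, hκ]
    · simp [hρ]
  refine ⟨π, ?_, ?_, ?_, ?_, ?_, ?_, ?_, ⟨LinearEquiv.ofBijective (κ.codRestrict _ hκker)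
    ⟨?_, ?_⟩⟩⟩
  · rintro ⟨p, hp⟩
    obtain ⟨α, β, γ, rfl⟩ := Submodule.mem_span_triple.mp hp
    exact ⟨θ ![0, α, β, γ, 0, 0], by rw [hπ]; exact Subtype.ext (by simp [hρ])⟩
  · exact hval ![1, 0, 0, 0, 0, 0] _ _ (by simp [hθ]) (by simp [hρ])
  · exact hval ![0, 1, 0, 0, 0, 0] _ _ (by simp [hθ]) (by simp [hρ])
  · exact hval ![0, 0, 1, 0, 0, 0] _ _ (by simp [hθ]) (by simp [hρ])
  · exact hval ![0, 0, 0, 1, 0, 0] _ _ (by simp [hθ]) (by simp [hρ])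
  · exact hval ![0, 0, 0, 0, 1, 0] _ _ (by simp [hθ]) (by simp [hρ])
  · exact hval ![0, 0, 0, 0, 0, 1] _ _ (by simp [hθ]) (by simp [hρ])
  · rw [injective_iff_map_eq_zero]
    intro t ht
    have h0 : (κ t : Ω) = 0 :=
      congrArg Subtype.val (congrArg Subtype.val ht)
    rw [hκ] at h0
    obtain ⟨h1, -, -, h3⟩ := hrel (t 0) 0 0 0 (t 1) (t 2) (by simpa using h0)
    have h1 := (mul_eq_zero.mp h1).resolve_left hz
    have h3 := (mul_eq_zero.mp h3).resolve_left hz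
    have hd0 : t 1 = 0 := by
      by_contra hne
      have hd0 : d = 0 := by
        have : algebraMap A Ω (t 1) * d = 0 := by simpa [h1, h3] using h0
        exact (mul_eq_zero.mp this).resolve_left
          fun h => hne (hinj (by rw [h, map_zero]))
      obtain ⟨-, hv, -, -⟩ := hrel 0 0 0 0 1 0 (by simp [hd0])
      have hv : v = 0 := by simpa using hv
      exact one_ne_zero (hind 0 0 1 0 (by simp [hv])).2.2.1
    ext i
    fin_cases i
    · exact h1
    · exact hd0
    · exact h3
  · rintro ⟨r, hr⟩
    obtain ⟨t, rfl⟩ := hθs r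
    have h0 : ρ t = 0 := by rw [← hπ]; exact hr
    obtain ⟨s, l, m, n, h1, h2, h3⟩ := hsyz (t 1) (t 2) (t 3)
      (by rw [← hρ, h0]; rfl)
    refine ⟨![t 0, t 4 + l * z + m * y + n * x, t 5], Subtype.ext (Subtype.ext ?_)⟩
    change (κ _ : Ω) = θ t
    rw [hκ, hθ, h1, h2, h3]
    simp only [Matrix.cons_val, map_add, map_mul, map_sub]
    linear_combination -algebraMap A Ω s * hxyz - algebraMap A Ω l * hzd
      - algebraMap A Ω m * hyd - algebraMap A Ω n * hxd

end Abstract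

section Hypersurface

variable {K : Type} [Field K]

theorem bMk_surjective : Function.Surjective (bMk K) :=
  Ideal.Quotient.mk_surjective

theorem bMk_eq_zero_iff {p : MvPolynomial (Fin 6) K} : bMk K p = 0 ↔ bPoly K ∣ p := by
  rw [← Ideal.mem_span_singleton]
  exact Ideal.Quotient.eq_zero_iff_mem

theorem bMk_mem_mIdeal {p : MvPolynomial (Fin 6) K} (hp : constantCoeff p = 0) :
    bMk K p ∈ mIdeal K := by
  have : p ∈ Ideal.span (X '' (Set.univ : Set (Fin 6))) := by
    rw [mem_ideal_span_X_image]
    intro m hm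
    by_contra! h
    have : m = 0 := by
      ext i
      exact h i (Set.mem_univ i)
    rw [mem_support_iff, this] at hm
    exact hm hp
  have := Ideal.mem_map_of_mem (bMk K) this
  rwa [Ideal.map_span, Set.image_univ, ← Set.range_comp] at this

/-- Exactness of the Koszul complex on the first three variables at its degree-one term. -/
theorem koszul_exact {P Q T : MvPolynomial (Fin 6) K} (h : P * X 0 + Q * X 1 + T * X 2 = 0) :
    ∃ l m n, P = l * X 1 + m * X 2 ∧ Q = -l * X 0 + n * X 2 ∧ T = -m * X 0 - n * X 1 := by
  have hT : T ∈ Ideal.span (X '' ({0, 1} : Set (Fin 6))) := by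
    have hTX : T * X 2 ∈ Ideal.span (X '' ({0, 1} : Set (Fin 6))) := by
      rw [Set.image_pair, Ideal.mem_span_pair]
      exact ⟨-P, -Q, by linear_combination -h⟩
    rw [mem_ideal_span_X_image] at hTX ⊢
    intro μ hμ
    obtain ⟨i, hi, hne⟩ := hTX (μ + Finsupp.single 2 1) (by
      rw [mem_support_iff, coeff_mul_X]; exact mem_support_iff.mp hμ)
    refine ⟨i, hi, ?_⟩
    rcases hi with rfl | rfl <;> simpa using hne
  rw [Set.image_pair, Ideal.mem_span_pair] at hT
  obtain ⟨m, n, rfl⟩ := hT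
  have hdvd : (X 0 : MvPolynomial (Fin 6) K) ∣ (Q + n * X 2) * X 1 :=
    ⟨-(P + m * X 2), by linear_combination h⟩
  have h01 : ¬ (X 0 : MvPolynomial (Fin 6) K) ∣ X 1 := by
    rw [X_dvd_X]
    decide
  obtain ⟨l, hl⟩ := ((X_prime (R := K)).dvd_or_dvd hdvd).resolve_right h01
  refine ⟨-l, -m, -n, ?_, by linear_combination hl, by ring⟩
  refine mul_right_cancel₀ (X_ne_zero (R := K) (0 : Fin 6)) ?_
  linear_combination h - X 1 * hl

variable [(mIdeal K).IsPrime]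

instance isLocalization_Aring : IsLocalization (mIdeal K).primeCompl (Aring K) :=
  inferInstanceAs (IsLocalization (mIdeal K).primeCompl (Localization (mIdeal K).primeCompl))

/-- The canonical map from the polynomial ring to `A`. -/
def polyToA (K : Type) [Field K] [(mIdeal K).IsPrime] : MvPolynomial (Fin 6) K →+* Aring K :=
  (algebraMap (Bring K) (Aring K)).comp (bMk K)

theorem polyToA_eq_zero_iff {p : MvPolynomial (Fin 6) K} :
    polyToA K p = 0 ↔ ∃ t, bMk K t ∉ mIdeal K ∧ bPoly K ∣ t * p := by
  rw [polyToA, RingHom.comp_apply,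
    IsLocalization.map_eq_zero_iff (mIdeal K).primeCompl (Aring K)]
  constructor
  · rintro ⟨⟨τ, hτ⟩, h⟩
    obtain ⟨t, rfl⟩ := bMk_surjective τ
    exact ⟨t, hτ, bMk_eq_zero_iff.mp (by rw [map_mul]; exact h)⟩
  · rintro ⟨t, ht, h⟩
    exact ⟨⟨bMk K t, ht⟩, by rw [← map_mul]; exact bMk_eq_zero_iff.mpr h⟩

theorem isUnit_polyToA {t : MvPolynomial (Fin 6) K} (ht : bMk K t ∉ mIdeal K) :
    IsUnit (polyToA K t) :=
  IsLocalization.map_units (Aring K) (⟨bMk K t, ht⟩ : (mIdeal K).primeCompl)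

theorem exists_common_denominator {n : ℕ} (g : Fin n → Aring K) :
    ∃ (s : MvPolynomial (Fin 6) K) (p : Fin n → MvPolynomial (Fin 6) K),
      bMk K s ∉ mIdeal K ∧ ∀ i, polyToA K s * g i = polyToA K (p i) := by
  obtain ⟨⟨σ, hσ⟩, h⟩ := IsLocalization.exist_integer_multiples_of_finite
    (mIdeal K).primeCompl g
  obtain ⟨s, rfl⟩ := bMk_surjective σ
  choose q hq using h
  choose p hp using fun i => bMk_surjective (q i)
  refine ⟨s, p, hσ, fun i => ?_⟩
  rw [polyToA, RingHom.comp_apply, RingHom.comp_apply, hp, hq, Algebra.smul_def]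

/-- In characteristic two, a derivation preserving the defining equation acts on the kernel of
the map to `A`. -/
theorem polyToA_derivation_eq_zero [CharP K 2]
    (D : Derivation K (MvPolynomial (Fin 6) K) (MvPolynomial (Fin 6) K))
    (hD : bPoly K ∣ D (bPoly K)) {p : MvPolynomial (Fin 6) K} (hp : polyToA K p = 0) :
    polyToA K (D p) = 0 := by
  have h2 : (2 : MvPolynomial (Fin 6) K) = 0 := CharTwo.two_eq_zero
  obtain ⟨t, ht, g, hg⟩ := polyToA_eq_zero_iff.mp hp
  obtain ⟨k, hk⟩ := hD
  refine polyToA_eq_zero_iff.mpr ⟨t ^ 2, ?_, ?_⟩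
  · rw [map_pow]
    exact fun h => ht (Ideal.IsPrime.mem_of_pow_mem inferInstance 2 h)
  · have h := congrArg D (congrArg (t * ·) hg)
    simp only [Derivation.leibniz, smul_eq_mul, hk] at h
    refine ⟨g * D t + t * D g + t * g * k, ?_⟩
    linear_combination h - p * t * D t * h2

theorem polyToA_bPoly : polyToA K (bPoly K) = 0 :=
  polyToA_eq_zero_iff.mpr ⟨1, by
    rw [map_one]; exact (Ideal.ne_top_iff_one _).mp (Ideal.IsPrime.ne_top inferInstance),
    Dvd.intro_left 1 rfl⟩

theorem polyToA_X_ne_zero (i : Fin 6) : polyToA K (X i) ≠ 0 := by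
  intro h
  obtain ⟨t, ht, g, hg⟩ := polyToA_eq_zero_iff.mp h
  have hc : constantCoeff t ≠ 0 := fun hc => ht (bMk_mem_mIdeal hc)
  let ψ : MvPolynomial (Fin 6) K →ₐ[K] DualNumber K := aeval (Pi.single i DualNumber.eps)
  have hψf : ψ (bPoly K) = 0 := by
    fin_cases i <;> simp [ψ, bPoly]
  have hfst : TrivSqZeroExt.fst (ψ t) = constantCoeff t := by
    have : ((TrivSqZeroExt.fstHom K K K).comp ψ) = aeval (fun _ => (0 : K)) := by
      ext j
      by_cases hj : j = i <;> simp [ψ, hj]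
    have := DFunLike.congr_fun this t
    simpa [MvPolynomial.aeval_zero'] using this
  have h0 := congrArg (fun q => TrivSqZeroExt.snd (ψ q)) hg
  simp only [map_mul, hψf, zero_mul] at h0
  simp [ψ] at h0
  exact hc (hfst ▸ h0)

theorem independent_polyToA [CharP K 2] [IsDomain (Aring K)] (α β γ ζ : Aring K)
    (h : α ^ 2 + β ^ 2 * (uElt K * yElt K * zElt K) + γ ^ 2 * (vElt K * xElt K * zElt K) +
      ζ ^ 2 * (vElt K * wElt K * yElt K * zElt K) = 0) :
    α = 0 ∧ β = 0 ∧ γ = 0 ∧ ζ = 0 := by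
  have h2 : (2 : MvPolynomial (Fin 6) K) = 0 := CharTwo.two_eq_zero
  let D₁ : Derivation K (MvPolynomial (Fin 6) K) (MvPolynomial (Fin 6) K) :=
    mkDerivation K ![X 0, X 1, X 2, 0, 0, 0]
  let D₂ : Derivation K (MvPolynomial (Fin 6) K) (MvPolynomial (Fin 6) K) :=
    mkDerivation K ![X 4, X 3, 0, 0, 0, 0]
  have hsq (D : Derivation K (MvPolynomial (Fin 6) K) (MvPolynomial (Fin 6) K)) (q) :
      D (q ^ 2) = 0 := by
    rw [pow_two, Derivation.leibniz, smul_eq_mul]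
    linear_combination q * D q * h2
  obtain ⟨s, p, hs, hp⟩ := exists_common_denominator ![α, β, γ, ζ]
  have hs0 := (isUnit_polyToA hs).ne_zero
  have p0 := hp 0
  have p1 := hp 1
  have p2 := hp 2
  have p3 := hp 3
  simp only [Matrix.cons_val] at p0 p1 p2 p3
  have hw := polyToA_X_ne_zero (K := K) 2
  have hx := polyToA_X_ne_zero (K := K) 3
  have hy := polyToA_X_ne_zero (K := K) 4
  have hz := polyToA_X_ne_zero (K := K) 5
  have hf := polyToA_bPoly (K := K)
  have hF : polyToA K (p 0 ^ 2 + p 1 ^ 2 * (X 0 * X 4 * X 5) + p 2 ^ 2 * (X 1 * X 3 * X 5) +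
      p 3 ^ 2 * (X 1 * X 2 * X 4 * X 5)) = 0 := by
    simp only [map_add, map_mul, map_pow, ← p0, ← p1, ← p2, ← p3]
    change α ^ 2 + β ^ 2 * (polyToA K (X 0) * polyToA K (X 4) * polyToA K (X 5)) +
      γ ^ 2 * (polyToA K (X 1) * polyToA K (X 3) * polyToA K (X 5)) +
      ζ ^ 2 * (polyToA K (X 1) * polyToA K (X 2) * polyToA K (X 4) * polyToA K (X 5)) = 0 at h
    linear_combination polyToA K s ^ 2 * h
  have hD₁ : bPoly K ∣ D₁ (bPoly K) := ⟨1, by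
    simp [D₁, bPoly, mkDerivation_X, Derivation.leibniz]; ring⟩
  have hD₂ : bPoly K ∣ D₂ (bPoly K) := ⟨0, by
    simp [D₂, bPoly, mkDerivation_X, Derivation.leibniz]; linear_combination X 3 * X 4 * h2⟩
  have E1 : polyToA K (p 1 ^ 2 * (X 0 * X 4 * X 5) + p 2 ^ 2 * (X 1 * X 3 * X 5)) = 0 := by
    rw [← polyToA_derivation_eq_zero D₁ hD₁ hF]
    congr 1
    simp only [map_add, Derivation.leibniz, hsq, smul_eq_mul, D₁, mkDerivation_X, Matrix.cons_val]
    linear_combination -p 3 ^ 2 * X 1 * X 2 * X 4 * X 5 * h2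
  have E2 : polyToA K (p 1 ^ 2 * (X 4 ^ 2 * X 5) + p 2 ^ 2 * (X 3 ^ 2 * X 5) +
      p 3 ^ 2 * (X 2 * X 3 * X 4 * X 5)) = 0 := by
    rw [← polyToA_derivation_eq_zero D₂ hD₂ hF]
    congr 1
    simp only [map_add, Derivation.leibniz, hsq, smul_eq_mul, D₂, mkDerivation_X, Matrix.cons_val]
    ring
  have E3 : polyToA K (p 1 ^ 2 * (X 4 ^ 2 * X 5) + p 2 ^ 2 * (X 3 ^ 2 * X 5)) = 0 := by
    rw [← polyToA_derivation_eq_zero D₂ hD₂ E1]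
    congr 1
    simp only [map_add, Derivation.leibniz, hsq, smul_eq_mul, D₂, mkDerivation_X, Matrix.cons_val]
    ring
  have k2 : (2 : Aring K) = 0 := by
    simpa only [map_ofNat, map_zero] using congrArg (polyToA K) h2
  simp only [bPoly, map_add, map_mul, map_pow, ← p0, ← p1, ← p2, ← p3] at E1 E2 E3 hF hf
  generalize polyToA K s = σ at *
  generalize polyToA K (X 0) = u at *
  generalize polyToA K (X 1) = v at *
  generalize polyToA K (X 2) = w at *
  generalize polyToA K (X 3) = x at *
  generalize polyToA K (X 4) = y at *
  generalize polyToA K (X 5) = z at *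
  have hζ : ζ = 0 := by
    have : (σ * ζ) ^ 2 * (w * x * y * z) = 0 := by linear_combination E2 - E3
    simpa [hs0, hw, hx, hy, hz] using this
  have hα : α = 0 := by
    have : (σ * α) ^ 2 = 0 := by
      linear_combination hF - E1 - σ ^ 2 * ζ * v * w * y * z * hζ
    simpa [hs0] using this
  have hβ : β = 0 := by
    have : (σ * β) ^ 2 * (w * x * y * z ^ 2) = 0 := by
      linear_combination x ^ 2 * E1 - v * x * E3 - (σ * β) ^ 2 * x * y * z * hf
        + (σ * β) ^ 2 * (v * x * y ^ 2 * z + w * x * y * z ^ 2) * k2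
    simpa [hs0, hw, hx, hy, hz] using this
  have hγ : γ = 0 := by
    have : (σ * γ) ^ 2 * (x ^ 2 * z) = 0 := by
      linear_combination E3 - σ ^ 2 * β * y ^ 2 * z * hβ
    simpa [hs0, hx, hz] using this
  exact ⟨hα, hβ, hγ, hζ⟩

theorem syzygies_polyToA (β γ δ : Aring K) (h : β * uElt K + γ * vElt K + δ * wElt K = 0) :
    ∃ s l m n : Aring K, β = s * xElt K + l * vElt K + m * wElt K ∧
      γ = s * yElt K - l * uElt K + n * wElt K ∧ δ = s * zElt K - m * uElt K - n * vElt K := by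
  obtain ⟨σ, p, hσ, hp⟩ := exists_common_denominator ![β, γ, δ]
  have p0 := hp 0
  have p1 := hp 1
  have p2 := hp 2
  simp only [Matrix.cons_val] at p0 p1 p2
  have hF : polyToA K (p 0 * X 0 + p 1 * X 1 + p 2 * X 2) = 0 := by
    simp only [map_add, map_mul, ← p0, ← p1, ← p2]
    change β * polyToA K (X 0) + γ * polyToA K (X 1) + δ * polyToA K (X 2) = 0 at h
    linear_combination polyToA K σ * h
  obtain ⟨t, ht, g, hg⟩ := polyToA_eq_zero_iff.mp hF
  obtain ⟨l, m, n, h0, h1, h2⟩ := koszul_exact (P := t * p 0 - g * X 3)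
    (Q := t * p 1 - g * X 4) (T := t * p 2 - g * X 5)
    (by rw [bPoly] at hg; linear_combination hg)
  obtain ⟨τ, hτ⟩ := ((isUnit_polyToA ht).mul (isUnit_polyToA hσ)).exists_left_inv
  have e0 := congrArg (polyToA K) h0
  have e1 := congrArg (polyToA K) h1
  have e2 := congrArg (polyToA K) h2
  simp only [map_add, map_sub, map_mul, map_neg, ← p0, ← p1, ← p2] at e0 e1 e2
  change ∃ s l m n : Aring K, β = s * polyToA K (X 3) + l * polyToA K (X 1) +
    m * polyToA K (X 2) ∧ γ = s * polyToA K (X 4) - l * polyToA K (X 0) + n * polyToA K (X 2) ∧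
    δ = s * polyToA K (X 5) - m * polyToA K (X 0) - n * polyToA K (X 1)
  refine ⟨τ * polyToA K g, τ * polyToA K l, τ * polyToA K m, τ * polyToA K n, ?_, ?_, ?_⟩
  · linear_combination τ * e0 - β * hτ
  · linear_combination τ * e1 - γ * hτ
  · linear_combination τ * e2 - δ * hτ

end Hypersurface

/-- There is a surjective `A`-module homomorphism `π : R → P` with
`π(1) = 0`, `π(a) = u`, `π(b) = v`, `π(c) = w`, `π(d) = 0`, `π(e) = 0`, whose kernel is a
free `A`-module of rank `3`; that is, there is a short exact sequence of `A`-modules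
`0 → A³ → R → P → 0`. -/
theorem ses_A_cubed_R_P
    (K : Type) [Field K] [CharP K 2] [(mIdeal K).IsPrime] [IsDomain (Aring K)]
    (a b c d e : Omega K)
    (ha : a ^ 2 = toOmega K (uElt K * yElt K * zElt K))
    (hb : b ^ 2 = toOmega K (vElt K * xElt K * zElt K))
    (hc : c ^ 2 = toOmega K (wElt K * xElt K * yElt K))
    (hd : d ^ 2 = toOmega K (uElt K * vElt K * wElt K))
    (he : e ^ 2 = toOmega K (vElt K * wElt K * yElt K * zElt K)) :
    ∃ π : adjoinT K a b c d e →ₗ[Aring K] Pideal K,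
      Function.Surjective π ∧
      π 1 = 0 ∧
      π (aT K a b c d e) = ⟨uElt K, Ideal.subset_span (by simp)⟩ ∧
      π (bT K a b c d e) = ⟨vElt K, Ideal.subset_span (by simp)⟩ ∧
      π (cT K a b c d e) = ⟨wElt K, Ideal.subset_span (by simp)⟩ ∧
      π (dT K a b c d e) = 0 ∧
      π (eT K a b c d e) = 0 ∧
      Nonempty ((Fin 3 → Aring K) ≃ₗ[Aring K] LinearMap.ker π) := by
  have h2 : (2 : Aring K) = 0 := by
    simpa only [map_ofNat, map_zero] using
      congrArg (polyToA K) (CharTwo.two_eq_zero : (2 : MvPolynomial (Fin 6) K) = 0)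
  have hinj : Function.Injective (algebraMap (Aring K) (Omega K)) :=
    (algebraMap (Lfield K) (Omega K)).injective.comp
      (IsFractionRing.injective (Aring K) (FractionRing (Aring K)))
  have hf : uElt K * xElt K + vElt K * yElt K + wElt K * zElt K = 0 := by
    have := polyToA_bPoly (K := K)
    simp only [bPoly, map_add, map_mul] at this
    exact this
  exact exists_ses_of_independent_of_syzygies h2 hinj hf (polyToA_X_ne_zero 5)
    independent_polyToA syzygies_polyToA ha hb hc hd he
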